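/- Let G and A be abelian groups. Then Ext¹(G, A) (the first Ext group over ℤ, equivalently Ext¹ in the category of abelian groups) is isomorphic to the quotient of the group of symmetric 2-cocycles — functions f : G × G → A satisfying f(x, y) = f(y, x) and f(x + y, z) + f(x, y) = f(x, y + z) + f(y, z) for all x, y, z in G — by the subgroup of coboundaries, i.e. those f for which there exists a function g : G → A (not necessarily a homomorphism) with f(x, y) = g(x + y) − g(x) − g(y) for all x, y. -/

import Mathlib

open CategoryTheory Opposite

universe u

/-- The group of symmetric 2-cocycles `f : G × G → A`, i.e. functions satisfying
`f(x,y) = f(y,x)` and `f(x+y,z) + f(x,y) = f(x,y+z) + f(y,z)`, under pointwise addition. -/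
def symmCocycles (G A : Type u) [AddCommGroup G] [AddCommGroup A] :
    AddSubgroup (G × G → A) where
  carrier := {f | (∀ x y, f (x, y) = f (y, x)) ∧
    ∀ x y z, f (x + y, z) + f (x, y) = f (x, y + z) + f (y, z)}
  add_mem' := by
    intro a b ha hb
    refine ⟨fun x y => by simp [Pi.add_apply, ha.1 x y, hb.1 x y], fun x y z => ?_⟩
    simp only [Pi.add_apply]
    rw [add_add_add_comm, ha.2 x y z, hb.2 x y z, add_add_add_comm]
  zero_mem' := ⟨fun x y => rfl, fun x y z => by simp⟩
  neg_mem' := by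
    intro a ha
    refine ⟨fun x y => by simp [Pi.neg_apply, ha.1 x y], fun x y z => ?_⟩
    simp only [Pi.neg_apply]
    rw [← neg_add, ← neg_add, ha.2 x y z]

/-- The coboundary homomorphism sending `g : G → A` to `(x, y) ↦ g(x+y) - g x - g y`.
Its range is the subgroup of 2-coboundaries. -/
def cobound (G A : Type u) [AddCommGroup G] [AddCommGroup A] :
    (G → A) →+ (G × G → A) :=
  AddMonoidHom.mk' (fun g p => g (p.1 + p.2) - g p.1 - g p.2)
    (fun g₁ g₂ => funext fun p => by simp only [Pi.add_apply]; abel)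

section SymmetricCocycles

variable {G A : Type u} [AddCommGroup G] [AddCommGroup A]

/-- A symmetric cocycle satisfies the normalisation `f (0, x) = f (0, 0)`. -/
lemma symmCocycles_zero_left {f : G × G → A} (hf : f ∈ symmCocycles G A) (x : G) :
    f (0, x) = f (0, 0) := by
  have h := hf.2 0 0 x
  simp only [zero_add] at h
  have h' : f (0, x) + f (0, 0) = f (0, x) + f (0, x) := h
  exact (add_left_cancel h').symm

/-- The set `A × G`, as the underlying set of the abelian extension of `G` by `A` defined by a
symmetric cocycle. -/
@[ext]
structure CocycleExtension (f : symmCocycles G A) where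
  /-- The `A`-coordinate. -/
  fst : A
  /-- The `G`-coordinate. -/
  snd : G

namespace CocycleExtension

variable (f : symmCocycles G A)

instance : Add (CocycleExtension f) :=
  ⟨fun a b => ⟨a.fst + b.fst + f.1 (a.snd, b.snd), a.snd + b.snd⟩⟩

instance : Zero (CocycleExtension f) := ⟨⟨-f.1 (0, 0), 0⟩⟩

instance : Neg (CocycleExtension f) :=
  ⟨fun a => ⟨-a.fst - f.1 (a.snd, -a.snd) - f.1 (0, 0), -a.snd⟩⟩

@[simp] lemma add_fst (a b : CocycleExtension f) :
    (a + b).fst = a.fst + b.fst + f.1 (a.snd, b.snd) := rfl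

@[simp] lemma add_snd (a b : CocycleExtension f) : (a + b).snd = a.snd + b.snd := rfl

@[simp] lemma zero_fst : (0 : CocycleExtension f).fst = -f.1 (0, 0) := rfl

@[simp] lemma zero_snd : (0 : CocycleExtension f).snd = 0 := rfl

@[simp] lemma neg_fst (a : CocycleExtension f) :
    (-a).fst = -a.fst - f.1 (a.snd, -a.snd) - f.1 (0, 0) := rfl

@[simp] lemma neg_snd (a : CocycleExtension f) : (-a).snd = -a.snd := rfl

protected lemma add_comm (a b : CocycleExtension f) : a + b = b + a := by
  ext
  · simp [f.2.1 a.snd b.snd, add_comm]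
  · simp [add_comm]

protected lemma zero_add (a : CocycleExtension f) : 0 + a = a := by
  ext
  · simp [symmCocycles_zero_left f.2 a.snd]
  · simp

protected lemma neg_add_cancel (a : CocycleExtension f) : -a + a = 0 := by
  ext
  · simp only [add_fst, neg_fst, neg_snd, zero_fst, f.2.1 (-a.snd) a.snd]
    abel
  · simp

instance : AddCommGroup (CocycleExtension f) where
  add_assoc a b c := by
    ext
    · have h := f.2.2 a.snd b.snd c.snd
      simp only [add_fst, add_snd]
      calc _ = a.fst + b.fst + c.fst +
            (f.1 (a.snd + b.snd, c.snd) + f.1 (a.snd, b.snd)) := by abel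
        _ = _ := by rw [h]; abel
    · simp [add_assoc]
  zero_add := CocycleExtension.zero_add f
  add_zero a := by rw [CocycleExtension.add_comm, CocycleExtension.zero_add]
  add_comm := CocycleExtension.add_comm f
  neg_add_cancel := CocycleExtension.neg_add_cancel f
  nsmul := nsmulRec
  zsmul := zsmulRec

/-- The projection of the extension onto `G`. -/
def proj : CocycleExtension f →+ G where
  toFun := snd
  map_zero' := rfl
  map_add' _ _ := rfl

lemma proj_surjective : Function.Surjective (proj f) := fun x => ⟨⟨0, x⟩, rfl⟩

end CocycleExtension

/-- The pullback of a symmetric cocycle along a homomorphism from a projective module is a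
coboundary. -/
lemma exists_cobound_comp_of_projective {P : Type u} [AddCommGroup P] [Module.Projective ℤ P]
    (π : P →+ G) (f : symmCocycles G A) :
    ∃ a : P → A, ∀ p q, a (p + q) = a p + a q + f.1 (π p, π q) := by
  obtain ⟨l, hl⟩ := Module.projective_lifting_property
    (CocycleExtension.proj f).toIntLinearMap π.toIntLinearMap (CocycleExtension.proj_surjective f)
  have hsnd : ∀ p, (l p).snd = π p := fun p => DFunLike.congr_fun hl p
  refine ⟨fun p => (l p).fst, fun p q => ?_⟩
  simp [map_add, hsnd]

variable {P₀ P₁ : Type u} [AddCommGroup P₀] [AddCommGroup P₁]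

section Presentation

variable {d : P₁ →+ P₀} {π : P₀ →+ G} {s : G → P₀} {t : G → G → P₁}

/-- Homomorphisms vanishing on `ker d` agree on elements with the same image under `d`. -/
lemma map_eq_of_map_eq {φ : P₁ →+ A} (hφ : ∀ p, d p = 0 → φ p = 0) {p q : P₁}
    (h : d p = d q) : φ p = φ q := by
  rw [← sub_eq_zero, ← map_sub]
  exact hφ _ (by rw [map_sub, h, sub_self])

/-- A homomorphism on the relations of a presentation of `G` restricts to a symmetric cocycle
on the relations `s x + s y - s (x + y)` given by a section `s`. -/
lemma comp_relations_mem_symmCocycles (ht : ∀ x y, d (t x y) = s x + s y - s (x + y))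
    {φ : P₁ →+ A} (hφ : ∀ p, d p = 0 → φ p = 0) :
    (fun x : G × G => φ (t x.1 x.2)) ∈ symmCocycles G A := by
  refine ⟨fun x y => map_eq_of_map_eq hφ ?_, fun x y z => ?_⟩
  · simp only [ht, add_comm]
  · simp only [← map_add]
    refine map_eq_of_map_eq hφ ?_
    simp only [map_add, ht, add_assoc]
    abel

/-- The cocycle of `φ` is a coboundary exactly when `φ` extends to the generators. -/
lemma comp_relations_mem_range_cobound_iff (hs : ∀ x, π (s x) = x)
    (hd : Function.Exact d π) (ht : ∀ x y, d (t x y) = s x + s y - s (x + y))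
    {φ : P₁ →+ A} (hφ : ∀ p, d p = 0 → φ p = 0) :
    (fun x : G × G => φ (t x.1 x.2)) ∈ (cobound G A).range ↔ ∃ ψ : P₀ →+ A, φ = ψ.comp d := by
  constructor
  · rintro ⟨g, hg⟩
    have hg' : ∀ x y, φ (t x y) = g (x + y) - g x - g y :=
      fun x y => (congrFun hg (x, y)).symm
    have hr : ∀ p, ∃ q, d q = p - s (π p) := fun p => (hd _).1 (by rw [map_sub, hs, sub_self])
    choose r hr using hr
    refine ⟨AddMonoidHom.mk' (fun p => φ (r p) - g (π p)) fun p q => ?_, ?_⟩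
    · have h : φ (r (p + q)) = φ (r p + r q + t (π p) (π q)) :=
        map_eq_of_map_eq hφ (by simp only [map_add, hr, ht]; abel)
      rw [h, map_add, map_add, hg', map_add]
      abel
    · ext p
      have h0 : π (d p) = 0 := hd.apply_apply_eq_zero p
      have h : φ (r (d p)) = φ (p - t 0 0) :=
        map_eq_of_map_eq hφ (by simp [hr, ht, h0])
      simp [h, h0, hg']
  · rintro ⟨ψ, rfl⟩
    refine ⟨fun x => -ψ (s x), funext fun x => ?_⟩
    simp only [cobound, AddMonoidHom.mk'_apply, AddMonoidHom.comp_apply, ht, map_add, map_sub]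
    abel

/-- Every symmetric cocycle is cohomologous to one that comes from the relations of a
projective presentation. -/
lemma exists_comp_relations_sub_mem_range_cobound [Module.Projective ℤ P₀]
    (hs : ∀ x, π (s x) = x) (hd : Function.Exact d π)
    (ht : ∀ x y, d (t x y) = s x + s y - s (x + y)) (f : symmCocycles G A) :
    ∃ φ : P₁ →+ A, (∀ p, d p = 0 → φ p = 0) ∧
      (fun x : G × G => φ (t x.1 x.2)) - f.1 ∈ (cobound G A).range := by
  obtain ⟨a, ha⟩ := exists_cobound_comp_of_projective π f
  have hπ : ∀ p, π (d p) = 0 := hd.apply_apply_eq_zero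
  have ha0 : a 0 + f.1 (0, 0) = 0 := by
    have h := ha 0 0
    rw [add_zero, add_assoc, map_zero] at h
    exact left_eq_add.1 h
  refine ⟨AddMonoidHom.mk' (fun p => a (d p) + f.1 (0, 0)) fun p q => ?_, fun p hp => ?_, ?_⟩
  · rw [map_add, ha, hπ, hπ]
    abel
  · simpa [hp] using ha0
  · refine ⟨fun x => -a (s x), funext fun ⟨x, y⟩ => ?_⟩
    have h₁ := ha (s x) (s y)
    have h₂ := ha (d (t x y)) (s (x + y))
    rw [ht, sub_add_cancel, ← ht, hπ, hs, symmCocycles_zero_left f.2, h₁, hs, hs] at h₂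
    have h₃ : a (d (t x y)) + f.1 (0, 0) = a (s x) + a (s y) + f.1 (x, y) - a (s (x + y)) := by
      rw [h₂]; abel
    simp only [cobound, AddMonoidHom.mk'_apply, Pi.sub_apply, h₃]
    abel

end Presentation

/-- The quotient of the symmetric cocycles by the coboundaries is the cokernel of restriction to
the relations of a projective presentation `P₁ → P₀ → G`. -/
theorem nonempty_quotient_symmCocycles_addEquiv [Module.Projective ℤ P₀]
    {d : P₁ →+ P₀} {π : P₀ →+ G} (hπ : Function.Surjective π) (hd : Function.Exact d π)
    {C : Type*} [AddCommGroup C] (B : AddSubgroup C) (ι : C →+ (P₁ →+ A))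
    (hι : ∀ φ, (∃ c, ι c = φ) ↔ ∀ p, d p = 0 → φ p = 0)
    (hB : ∀ c, c ∈ B ↔ ∃ ψ : P₀ →+ A, ι c = ψ.comp d) :
    Nonempty ((symmCocycles G A ⧸ (cobound G A).range.addSubgroupOf (symmCocycles G A)) ≃+
      C ⧸ B) := by
  choose s hs using hπ
  have ht : ∀ x y, ∃ p, d p = s x + s y - s (x + y) := fun x y =>
    (hd _).1 (by simp [hs])
  choose t ht using ht
  have hc : ∀ c p, d p = 0 → ι c p = 0 := fun c => (hι _).1 ⟨c, rfl⟩
  let θ : C →+ symmCocycles G A := AddMonoidHom.mk'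
    (fun c => ⟨fun x => ι c (t x.1 x.2), comp_relations_mem_symmCocycles ht (hc c)⟩)
    fun c c' => Subtype.ext (funext fun x => by simp)
  let Θ := (QuotientAddGroup.mk' ((cobound G A).range.addSubgroupOf (symmCocycles G A))).comp θ
  have hker : Θ.ker = B := by
    ext c
    rw [AddMonoidHom.mem_ker, hB, ← comp_relations_mem_range_cobound_iff hs hd ht (hc c)]
    exact (QuotientAddGroup.eq_zero_iff _).trans AddSubgroup.mem_addSubgroupOf
  have hsurj : Function.Surjective Θ := by
    intro z
    obtain ⟨f, rfl⟩ := QuotientAddGroup.mk_surjective z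
    obtain ⟨φ, hφ, h⟩ := exists_comp_relations_sub_mem_range_cobound hs hd ht f
    obtain ⟨c, rfl⟩ := (hι φ).2 hφ
    refine ⟨c, QuotientAddGroup.eq_iff_sub_mem.2 ?_⟩
    exact AddSubgroup.mem_addSubgroupOf.2 h
  exact ⟨((QuotientAddGroup.quotientAddEquivOfEq hker.symm).trans
    (QuotientAddGroup.quotientKerEquivOfSurjective Θ hsurj)).symm⟩

end SymmetricCocycles

/-- For abelian groups `G` and `A`, the first Ext group `Ext¹(G, A)`
(computed in the abelian category of `ℤ`-modules, equivalently abelian groups) is isomorphic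
to the quotient of the group of symmetric 2-cocycles by the subgroup of coboundaries. -/
theorem ext_iso_symmetric_cocycles_quotient (G A : Type u)
    [AddCommGroup G] [AddCommGroup A] :
    Nonempty
      ((↥(symmCocycles G A) ⧸
          ((AddMonoidHom.range (cobound G A)).addSubgroupOf (symmCocycles G A))) ≃+
        (((Ext ℤ (ModuleCat.{u} ℤ) 1).obj (op (ModuleCat.of ℤ G))).obj (ModuleCat.of ℤ A))) := by
  let X := ModuleCat.of ℤ G
  let Y := ModuleCat.of ℤ A
  let P := ProjectiveResolution.of X
  let S := (P.complex.linearYonedaObj ℤ Y).sc' 0 1 2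
  let e : ((Ext ℤ (ModuleCat.{u} ℤ) 1).obj (op X)).obj Y ≅
      ModuleCat.of ℤ (LinearMap.ker S.g.hom ⧸ LinearMap.range S.moduleCatToCycles) :=
    P.isoExt 1 Y ≪≫ HomologicalComplex.homologyIsoSc' _ 0 1 2 (by simp) (by simp) ≪≫
      S.moduleCatHomologyIso
  let π : P.complex.X 0 ⟶ X := P.π.f 0
  have hd : Function.Exact (P.complex.d 1 0).hom π.hom :=
    (ShortComplex.ShortExact.moduleCat_exact_iff_function_exact _).1 P.exact₀
  have hd' : Function.Exact (P.complex.d 2 1).hom (P.complex.d 1 0).hom :=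
    (ShortComplex.ShortExact.moduleCat_exact_iff_function_exact _).1 (P.exact_succ 0)
  have hπ : Function.Surjective π.hom :=
    (ModuleCat.epi_iff_surjective _).1 (inferInstanceAs (Epi (P.π.f 0)))
  have hproj : Module.Projective ℤ (P.complex.X 0) :=
    (P.complex.X 0).projective_of_module_projective
  have : @Module.Projective ℤ _ (P.complex.X 0) _ (AddCommGroup.toIntModule _) := by
    convert hproj
    exact Subsingleton.elim _ _
  let ι : LinearMap.ker S.g.hom →+ (P.complex.X 1 →+ A) := AddMonoidHom.mk'
    (fun c => ((c.1 : P.complex.X 1 ⟶ Y).hom : P.complex.X 1 →ₗ[ℤ] A).toAddMonoidHom)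
    fun c c' => rfl
  have hι : ∀ φ, (∃ c, ι c = φ) ↔ ∀ p, (P.complex.d 1 0).hom p = 0 → φ p = 0 := fun φ => by
    constructor
    · rintro ⟨c, rfl⟩ p hp
      obtain ⟨q, rfl⟩ := (hd' p).1 hp
      have h : P.complex.d 2 1 ≫ (c.1 : P.complex.X 1 ⟶ Y) = 0 := c.2
      exact DFunLike.congr_fun (ModuleCat.hom_ext_iff.1 h) q
    · intro h
      refine ⟨⟨(ModuleCat.ofHom ⟨φ.toAddHom, map_intCast_smul φ ℤ ℤ⟩ : P.complex.X 1 ⟶ Y), ?_⟩, rfl⟩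
      refine ModuleCat.hom_ext (LinearMap.ext fun q => ?_)
      exact h _ (hd'.apply_apply_eq_zero q)
  have hB : ∀ c, c ∈ (LinearMap.range S.moduleCatToCycles).toAddSubgroup ↔
      ∃ ψ : P.complex.X 0 →+ A, ι c = ψ.comp (P.complex.d 1 0).hom.toAddMonoidHom := fun c => by
    constructor
    · rintro ⟨ψ, rfl⟩
      exact ⟨((ψ : P.complex.X 0 ⟶ Y).hom : P.complex.X 0 →ₗ[ℤ] A).toAddMonoidHom, rfl⟩
    · rintro ⟨ψ, hψ⟩
      refine ⟨(ModuleCat.ofHom ⟨ψ.toAddHom, map_intCast_smul ψ ℤ ℤ⟩ : P.complex.X 0 ⟶ Y),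
        Subtype.ext ?_⟩
      exact ModuleCat.hom_ext (LinearMap.ext fun p => (DFunLike.congr_fun hψ p).symm)
  obtain ⟨E⟩ := nonempty_quotient_symmCocycles_addEquiv (π := π.hom.toAddMonoidHom) hπ hd
    (LinearMap.range S.moduleCatToCycles).toAddSubgroup ι hι hB
  exact ⟨E.trans e.toLinearEquiv.toAddEquiv.symm⟩
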